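/- arXiv:2205.10010 — 9 statements merged into one kernel-verified Lean document; each statement's English description precedes it below -/
import Mathlib

section
/- Let λ be a nonzero real number, let r, k be positive integers, and let n be a nonnegative integer. Define q_m(λ) = (1/λ)·( (−1)^m · C(λ−r, m) / C(r+m−1, m) − 1 ) for m ≥ 1. Then C(n+k, k) · H_{n+k,λ}^{(r)} = C(n+r+k−1, n) · H_k^{(r)} + C(r+k−1, k) · H_{n,λ}^{(k+r)} + λ·[ C(n+r+k−1, n) · C(r+k−1, k) · Σ_{l=2}^{k} q_{l−1}(λ)/(r+l−1) + C(r+k−1, k) · q_k(λ) · H_{n,λ}^{(k+r)} ]. -/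
/-- Generalized binomial coefficient `C(x, n) = x(x-1)⋯(x-n+1)/n!`. -/
noncomputable def gbinom (x : ℝ) (n : ℕ) : ℝ :=
  (∏ i ∈ Finset.range n, (x - i)) / (Nat.factorial n)

/-- Degenerate harmonic numbers `H_{n,λ} = Σ_{j=1}^n (-1)^{j-1} (1/λ) C(λ, j)`, with `H_{0,λ} = 0`. -/
noncomputable def degHarmonic (lam : ℝ) (n : ℕ) : ℝ :=
  ∑ j ∈ Finset.Icc 1 n, (-1 : ℝ) ^ (j - 1) * (1 / lam) * gbinom lam j

/-- Degenerate hyperharmonic numbers: `H_{0,λ}^{(r)} = 0`, `H_{n,λ}^{(1)} = H_{n,λ}`,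
and `H_{n,λ}^{(r)} = Σ_{j=1}^n H_{j,λ}^{(r-1)}` for `r ≥ 2`. -/
noncomputable def degHyperharmonic (lam : ℝ) : ℕ → ℕ → ℝ
  | 0, _ => 0
  | 1, n => degHarmonic lam n
  | r + 2, n => ∑ j ∈ Finset.Icc 1 n, degHyperharmonic lam (r + 1) j

/-- Harmonic numbers `H_n = Σ_{j=1}^n 1/j`, with `H_0 = 0`. -/
noncomputable def harmonicR (n : ℕ) : ℝ := ∑ j ∈ Finset.Icc 1 n, (1 : ℝ) / j

/-- Hyperharmonic numbers: `H_n^{(0)} = 1/n`, `H_n^{(1)} = H_n`,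
and `H_n^{(r)} = Σ_{j=1}^n H_j^{(r-1)}` for `r ≥ 2` (and `H_0^{(r)} = 0`). -/
noncomputable def hyperharmonicR : ℕ → ℕ → ℝ
  | 0, n => if n = 0 then 0 else (1 : ℝ) / n
  | 1, n => harmonicR n
  | r + 2, n => ∑ j ∈ Finset.Icc 1 n, hyperharmonicR (r + 1) j

theorem gb_zero (x : ℝ) : gbinom x 0 = 1 := by simp [gbinom]

theorem gb_succ (x : ℝ) (n : ℕ) : gbinom x (n+1) * (n+1) = gbinom x n * (x - n) := by
  have h : (n.factorial : ℝ) ≠ 0 := by exact_mod_cast n.factorial_ne_zero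
  have h2 : (n : ℝ) + 1 ≠ 0 := by positivity
  unfold gbinom
  rw [Finset.prod_range_succ, Nat.factorial_succ]
  push_cast
  field_simp

theorem gb_succ' (x : ℝ) (n : ℕ) : gbinom x (n+1) * (n+1) = x * gbinom (x-1) n := by
  have h : (n.factorial : ℝ) ≠ 0 := by exact_mod_cast n.factorial_ne_zero
  have h2 : (n : ℝ) + 1 ≠ 0 := by positivity
  have h3 : ∏ i ∈ Finset.range n, (x - ((i+1 : ℕ) : ℝ)) = ∏ i ∈ Finset.range n, (x - 1 - i) := by
    apply Finset.prod_congr rfl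
    intro i _
    push_cast
    ring
  unfold gbinom
  rw [Finset.prod_range_succ', Nat.factorial_succ, h3]
  push_cast
  field_simp
  ring

theorem gb_pascal (x : ℝ) (n : ℕ) : gbinom x (n+1) = gbinom (x-1) (n+1) + gbinom (x-1) n := by
  have h2 : (n : ℝ) + 1 ≠ 0 := by positivity
  apply mul_right_cancel₀ h2
  rw [gb_succ', add_mul, gb_succ]
  ring

theorem gb_nat (N m : ℕ) : gbinom (N : ℝ) m = (N.choose m : ℝ) := by
  induction N generalizing m with
  | zero =>
    cases m with
    | zero => simp [gbinom]
    | succ m => simp [gbinom, Finset.prod_range_succ']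
  | succ N ih =>
    cases m with
    | zero => simp [gbinom]
    | succ m =>
      rw [gb_pascal, Nat.choose_succ_succ]
      push_cast
      rw [add_sub_cancel_right, ih, ih]
      ring

theorem gb_mul (x : ℝ) (n k : ℕ) :
    ((n + k).choose k : ℝ) * gbinom x (n + k) = gbinom x k * gbinom (x - k) n := by
  have h3 : ∏ i ∈ Finset.range n, (x - ((k + i : ℕ) : ℝ)) = ∏ i ∈ Finset.range n, (x - k - i) := by
    apply Finset.prod_congr rfl
    intro i _
    push_cast
    ring
  have h := Nat.add_choose_mul_factorial_mul_factorial k n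
  rw [← Nat.choose_symm_add] at h
  have h' : ((k + n).choose k : ℝ) * k.factorial * n.factorial = (k + n).factorial := by
    exact_mod_cast h
  have hn : (n.factorial : ℝ) ≠ 0 := by exact_mod_cast n.factorial_ne_zero
  have hk : (k.factorial : ℝ) ≠ 0 := by exact_mod_cast k.factorial_ne_zero
  have hnk : ((k + n).factorial : ℝ) ≠ 0 := by exact_mod_cast (k + n).factorial_ne_zero
  rw [add_comm n k]
  unfold gbinom
  rw [Finset.prod_range_add, h3]
  field_simp
  rw [← h']
  ring

theorem deg_formula (lam : ℝ) (hlam : lam ≠ 0) (s n : ℕ) :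
    degHyperharmonic lam (s + 1) n =
      (1 / lam) * (((s + n).choose n : ℝ) - (-1) ^ n * gbinom (lam - (s + 1 : ℕ)) n) := by
  induction s generalizing n with
  | zero =>
    induction n with
    | zero => simp [degHyperharmonic, degHarmonic, gb_zero]
    | succ n ih =>
      have e : degHyperharmonic lam (0 + 1) (n + 1) =
          degHyperharmonic lam (0 + 1) n + (-1 : ℝ) ^ n * (1 / lam) * gbinom lam (n + 1) := by
        simp [degHyperharmonic, degHarmonic, Finset.sum_Icc_succ_top]
      rw [e, ih, gb_pascal lam]
      simp only [zero_add, Nat.choose_self, Nat.cast_one]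
      ring
  | succ s ihs =>
    induction n with
    | zero => simp [degHyperharmonic, gb_zero]
    | succ n ih =>
      have e : degHyperharmonic lam (s + 1 + 1) (n + 1) =
          degHyperharmonic lam (s + 1 + 1) n + degHyperharmonic lam (s + 1) (n + 1) := by
        simp [degHyperharmonic, Finset.sum_Icc_succ_top]
      rw [e, ih, ihs, gb_pascal (lam - (s + 1 : ℕ))]
      have e2 : lam - ((s + 1 : ℕ) : ℝ) - 1 = lam - ((s + 1 + 1 : ℕ) : ℝ) := by
        push_cast
        ring
      have e3 : (s + 1 + (n + 1)).choose (n + 1) =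
          (s + 1 + n).choose n + (s + (n + 1)).choose (n + 1) := by
        rw [show s + 1 + (n + 1) = (s + 1 + n) + 1 by ring, Nat.choose_succ_succ]
        congr 2
        ring
      rw [e2, e3]
      push_cast
      ring

theorem hyper_formula (s k : ℕ) :
    hyperharmonicR (s + 1) k =
      ((s + k).choose k : ℝ) * ∑ l ∈ Finset.range k, 1 / ((s : ℝ) + 1 + l) := by
  induction s generalizing k with
  | zero =>
    induction k with
    | zero => simp [hyperharmonicR, harmonicR]
    | succ k ih =>
      have e : hyperharmonicR (0 + 1) (k + 1) =
          hyperharmonicR (0 + 1) k + 1 / ((k : ℝ) + 1) := by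
        simp [hyperharmonicR, harmonicR, Finset.sum_Icc_succ_top]
      rw [e, ih, Finset.sum_range_succ]
      simp [add_comm]
  | succ s ihs =>
    induction k with
    | zero => simp [hyperharmonicR]
    | succ k ih =>
      have e : hyperharmonicR (s + 1 + 1) (k + 1) =
          hyperharmonicR (s + 1 + 1) k + hyperharmonicR (s + 1) (k + 1) := by
        simp [hyperharmonicR, Finset.sum_Icc_succ_top]
      have e3 : (s + 1 + (k + 1)).choose (k + 1) =
          (s + 1 + k).choose k + (s + (k + 1)).choose (k + 1) := by
        rw [show s + 1 + (k + 1) = (s + 1 + k) + 1 by ring, Nat.choose_succ_succ]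
        congr 2
        ring
      have e4 : (s + (k + 1)).choose (k + 1) * (s + k + 2) =
          (s + 1 + (k + 1)).choose (k + 1) * (s + 1) := by
        have h := Nat.choose_mul_succ_eq (s + (k + 1)) (k + 1)
        rw [show s + (k + 1) + 1 - (k + 1) = s + 1 by omega] at h
        rw [show s + 1 + (k + 1) = s + (k + 1) + 1 by ring, ← h]
        ring
      have e5 : ((s + (k + 1)).choose (k + 1) : ℝ) * (s + k + 2) =
          ((s + 1 + (k + 1)).choose (k + 1) : ℝ) * (s + 1) := by exact_mod_cast e4
      have e3' : ((s + 1 + (k + 1)).choose (k + 1) : ℝ) =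
          (s + 1 + k).choose k + (s + (k + 1)).choose (k + 1) := by exact_mod_cast e3
      have e6 : ∑ l ∈ Finset.range (k + 1), 1 / ((s : ℝ) + 1 + l) =
          ∑ l ∈ Finset.range k, 1 / (((s + 1 : ℕ) : ℝ) + 1 + l) + 1 / ((s : ℝ) + 1) := by
        rw [Finset.sum_range_succ']
        simp only [Nat.cast_zero, add_zero]
        congr 1
        apply Finset.sum_congr rfl
        intro i _
        push_cast
        congr 1
        ring
      rw [e, ih, ihs, e6, Finset.sum_range_succ]
      generalize ∑ l ∈ Finset.range k, 1 / (((s + 1 : ℕ) : ℝ) + 1 + l) = S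
      have h1 : (s : ℝ) + 1 ≠ 0 := by positivity
      have h2 : (s : ℝ) + k + 2 ≠ 0 := by positivity
      have e7 : ((s + (k + 1)).choose (k + 1) : ℝ) * (1 / (s + 1)) =
          ((s + 1 + (k + 1)).choose (k + 1) : ℝ) * (1 / (((s + 1 : ℕ) : ℝ) + 1 + k)) := by
        rw [show ((s + 1 : ℕ) : ℝ) + 1 + k = (s : ℝ) + k + 2 by push_cast; ring]
        field_simp
        linarith
      rw [mul_add, mul_add, e7, e3']
      ring

theorem choose_pos_real (s k : ℕ) : ((s + k).choose k : ℝ) ≠ 0 := by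
  have := Nat.choose_pos (Nat.le_add_left k s)
  positivity

theorem ratio_succ (lam : ℝ) (s l : ℕ) :
    (-1 : ℝ) ^ (l + 1) * gbinom (lam - (s + 1 : ℕ)) (l + 1) / ((s + (l + 1)).choose (l + 1) : ℝ) =
    (-1 : ℝ) ^ l * gbinom (lam - (s + 1 : ℕ)) l / ((s + l).choose l : ℝ)
      * (1 - lam / ((s : ℝ) + 1 + l)) := by
  have h1 := gb_succ (lam - (s + 1 : ℕ)) l
  have h2 : ((s + (l + 1)).choose (l + 1) : ℝ) * (l + 1) = (s + 1 + l) * (s + l).choose l := by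
    have := Nat.add_one_mul_choose_eq (s + l) l
    rw [show s + (l + 1) = s + l + 1 by ring]
    have h : ((s + l + 1 : ℕ) : ℝ) * (s + l).choose l = (s + l + 1).choose (l + 1) * (l + 1 : ℕ) := by
      exact_mod_cast this
    push_cast at h
    linarith
  have c1 := choose_pos_real s (l + 1)
  have c2 := choose_pos_real s l
  have h3 : (l : ℝ) + 1 ≠ 0 := by positivity
  have h4 : (s : ℝ) + 1 + l ≠ 0 := by positivity
  have g : gbinom (lam - (s + 1 : ℕ)) (l + 1) =
      gbinom (lam - (s + 1 : ℕ)) l * (lam - (s + 1 : ℕ) - l) / (l + 1) := by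
    field_simp
    linarith
  have c : ((s + (l + 1)).choose (l + 1) : ℝ) = (s + 1 + l) * (s + l).choose l / (l + 1) := by
    field_simp
    linarith
  rw [g, c]
  push_cast
  field_simp
  ring

theorem key (lam : ℝ) (hlam : lam ≠ 0) (s k : ℕ) (hk : 1 ≤ k) (q : ℕ → ℝ)
    (hq : ∀ m : ℕ, 1 ≤ m → lam * q m =
      (-1 : ℝ) ^ m * gbinom (lam - (s + 1 : ℕ)) m / ((s + m).choose m : ℝ) - 1) :
    (1 / lam) * (1 - (-1 : ℝ) ^ k * gbinom (lam - (s + 1 : ℕ)) k / ((s + k).choose k : ℝ)) =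
      ∑ l ∈ Finset.range k, 1 / ((s : ℝ) + 1 + l) +
      lam * ∑ l ∈ Finset.Icc 2 k, q (l - 1) / (((s + 1 : ℕ) : ℝ) + l - 1) := by
  induction k, hk using Nat.le_induction with
  | base =>
    have h := ratio_succ lam s 0
    have h4 : (s : ℝ) + 1 ≠ 0 := by positivity
    rw [zero_add] at h
    rw [h]
    simp [gb_zero]
    field_simp
  | succ k hk ih =>
    have h4 : (s : ℝ) + 1 + k ≠ 0 := by positivity
    rw [Finset.sum_range_succ, Finset.sum_Icc_succ_top (by omega), mul_add, Nat.add_sub_cancel,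
      mul_div_assoc', hq k hk, ratio_succ]
    rw [show ((s + 1 : ℕ) : ℝ) + (k + 1 : ℕ) - 1 = (s : ℝ) + 1 + k by push_cast; ring]
    generalize (-1 : ℝ) ^ k * gbinom (lam - (s + 1 : ℕ)) k / ((s + k).choose k : ℝ) = b at *
    have : (1 / lam) * (1 - b * (1 - lam / ((s : ℝ) + 1 + k))) =
        (1 / lam) * (1 - b) + b / ((s : ℝ) + 1 + k) := by
      field_simp
      ring
    rw [this, ih]
    ring

/-- Theorem 2 of the paper: the identity relating degenerate hyperharmonic numbers,
hyperharmonic numbers and the polynomials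
`q_m(λ) = (1/λ)((-1)^m C(λ-r,m)/C(r+m-1,m) - 1)`. -/
theorem degHyperharmonic_identity (lam : ℝ) (hlam : lam ≠ 0) (r k : ℕ) (hr : 1 ≤ r)
    (hk : 1 ≤ k) (n : ℕ)
    (q : ℕ → ℝ)
    (hq : ∀ m : ℕ, 1 ≤ m →
      q m = (1 / lam) * ((-1 : ℝ) ^ m * gbinom (lam - r) m / gbinom ((r : ℝ) + m - 1) m - 1)) :
    ((n + k).choose k : ℝ) * degHyperharmonic lam r (n + k) =
      ((n + r + k - 1).choose n : ℝ) * hyperharmonicR r k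
        + ((r + k - 1).choose k : ℝ) * degHyperharmonic lam (k + r) n
        + lam * (((n + r + k - 1).choose n : ℝ) * ((r + k - 1).choose k : ℝ) *
              (∑ l ∈ Finset.Icc 2 k, q (l - 1) / ((r : ℝ) + l - 1))
            + ((r + k - 1).choose k : ℝ) * q k * degHyperharmonic lam (k + r) n) := by
  obtain ⟨s, rfl⟩ : ∃ s, r = s + 1 := ⟨r - 1, by omega⟩
  have hq' : ∀ m : ℕ, 1 ≤ m → lam * q m =
      (-1 : ℝ) ^ m * gbinom (lam - (s + 1 : ℕ)) m / ((s + m).choose m : ℝ) - 1 := by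
    intro m hm
    rw [hq m hm, ← gb_nat (s + m) m]
    rw [show ((s + 1 : ℕ) : ℝ) + m - 1 = ((s + m : ℕ) : ℝ) by push_cast; ring]
    field_simp
  have hkey := key lam hlam s k hk q hq'
  have c := choose_pos_real s k
  rw [show n + (s + 1) + k - 1 = s + k + n by omega, show s + 1 + k - 1 = s + k by omega,
    show k + (s + 1) = (s + k) + 1 by ring, deg_formula lam hlam, deg_formula lam hlam,
    hyper_formula]
  have hqk := hq' k hk
  have m1 := gb_mul (lam - (s + 1 : ℕ)) n k
  have m2 := gb_mul ((s + k + n : ℕ) : ℝ) n k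
  have m3 : ((n + k).choose k : ℝ) * ((s + (n + k)).choose (n + k) : ℝ) =
      ((s + k + n).choose n : ℝ) * ((s + k).choose k : ℝ) := by
    have a1 := Nat.add_choose_mul_factorial_mul_factorial n k
    have h := Nat.choose_mul (n := s + k + n) (k := n + k) (s := n) (by omega)
    rw [show s + k + n - n = s + k by omega, show n + k - n = k by omega,
      Nat.choose_symm_add] at h
    rw [show s + (n + k) = s + k + n by ring]
    have h' : ((s + k + n).choose (n + k) : ℝ) * ((n + k).choose k : ℝ) =
      ((s + k + n).choose n : ℝ) * ((s + k).choose k : ℝ) := by exact_mod_cast h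
    linarith
  rw [show lam - ((s + 1 : ℕ) : ℝ) - k = lam - ((s + k + 1 : ℕ) : ℝ) by push_cast; ring] at m1
  generalize ∑ l ∈ Finset.Icc 2 k, q (l - 1) / (((s + 1 : ℕ) : ℝ) + l - 1) = T at *
  generalize ∑ l ∈ Finset.range k, 1 / ((s : ℝ) + 1 + l) = S at *
  generalize gbinom (lam - ((s + k + 1 : ℕ) : ℝ)) n = G at *
  generalize gbinom (lam - ((s + 1 : ℕ) : ℝ)) (n + k) = A at *
  generalize gbinom (lam - ((s + 1 : ℕ) : ℝ)) k = B at *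
  generalize ((s + k).choose k : ℝ) = C at *
  generalize ((s + k + n).choose n : ℝ) = D at *
  have hC : C * (lam * q k) = (-1) ^ k * B - C := by
    rw [hqk]
    field_simp
  have hk2 : C * (S + lam * T) = (1 / lam) * (C - (-1) ^ k * B) := by
    rw [← hkey]
    field_simp
  rw [pow_add]
  linear_combination (1 / lam) * m3 - (1 / lam) * (-1) ^ n * (-1) ^ k * m1 - D * hk2
    - (1 / lam) * (D - (-1) ^ n * G) * hC
end

section
/- Let λ be a nonzero real number, let r, k be positive integers, and let n be a nonnegative integer. Then C(n+k, k) · H_{n+k,λ}^{(r)} = C(n+r+k−1, n) · H_k^{(r)} + C(n+r+k−1, n) · C(r+k−1, k) · [ Σ_{l=2}^{k} (−1)^{l−1} C(λ−r, l−1) / ( C(r+l−2, l−1) · (r+l−1) ) − Σ_{l=2}^{k} 1/(r+l−1) ] + (−1)^k · C(λ−r, k) · H_{n,λ}^{(k+r)}, where C(x, m) = x(x−1)⋯(x−m+1)/m! is the generalized binomial coefficient. -/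
lemma gbinom_succ (x : ℝ) (n : ℕ) : ((n : ℝ) + 1) * gbinom x (n + 1) = (x - n) * gbinom x n := by
  unfold gbinom
  rw [Finset.prod_range_succ, Nat.factorial_succ]
  have h : ((Nat.factorial n : ℕ) : ℝ) ≠ 0 := by exact_mod_cast Nat.factorial_ne_zero n
  have h2 : ((n : ℝ) + 1) ≠ 0 := by positivity
  push_cast
  field_simp

lemma gbinom_nat (s k : ℕ) : gbinom ((s : ℝ) + k) k = ((s + k).choose k : ℝ) := by
  have key : ∀ j, j ≤ s + k → gbinom ((s : ℝ) + k) j = ((s + k).choose j : ℝ) := by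
    intro j
    induction j with
    | zero => intro _; simp [gbinom]
    | succ j ih =>
      intro hj
      have h1 := gbinom_succ ((s : ℝ) + k) j
      rw [ih (by omega)] at h1
      have h2 := Nat.choose_succ_right_eq (s + k) j
      have h3 : (((s + k).choose (j + 1) : ℕ) : ℝ) * ((j : ℝ) + 1)
          = ((s + k).choose j : ℝ) * ((s : ℝ) + k - j) := by
        have := congrArg (Nat.cast : ℕ → ℝ) h2
        rw [Nat.cast_mul, Nat.cast_mul, Nat.cast_sub (by omega)] at this
        push_cast at this
        exact this
      have h4 : ((j : ℝ) + 1) ≠ 0 := by positivity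
      apply mul_left_cancel₀ h4
      linarith
  exact key k (by omega)

lemma deg_zero (lam : ℝ) (s : ℕ) : degHyperharmonic lam (s + 1) 0 = 0 := by
  cases s <;> simp [degHyperharmonic, degHarmonic]

lemma hyp_zero (s : ℕ) : hyperharmonicR (s + 1) 0 = 0 := by
  cases s <;> simp [hyperharmonicR, harmonicR]

lemma deg_succ (lam : ℝ) (s n : ℕ) : degHyperharmonic lam (s + 2) (n + 1)
    = degHyperharmonic lam (s + 2) n + degHyperharmonic lam (s + 1) (n + 1) := by
  simp only [degHyperharmonic]
  rw [Finset.sum_Icc_succ_top (by omega)]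

lemma hyp_succ (s n : ℕ) : hyperharmonicR (s + 2) (n + 1)
    = hyperharmonicR (s + 2) n + hyperharmonicR (s + 1) (n + 1) := by
  simp only [hyperharmonicR]
  rw [Finset.sum_Icc_succ_top (by omega)]

lemma degHarmonic_succ (lam : ℝ) (n : ℕ) : degHarmonic lam (n + 1)
    = degHarmonic lam n + (-1 : ℝ) ^ n * (1 / lam) * gbinom lam (n + 1) := by
  unfold degHarmonic
  rw [Finset.sum_Icc_succ_top (by omega)]
  simp

lemma deg_term (lam : ℝ) (hlam : lam ≠ 0) (n : ℕ) :
    ((n : ℝ) + 1) * ((-1 : ℝ) ^ n * (1 / lam) * gbinom lam (n + 1))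
      = 1 - lam * degHarmonic lam n := by
  induction n with
  | zero => simp [degHarmonic, gbinom, hlam]
  | succ n ih =>
    rw [degHarmonic_succ]
    have h := gbinom_succ lam (n + 1)
    push_cast at h ⊢
    rw [pow_succ]
    linear_combination ih - (-1 : ℝ) ^ n * (1 / lam) * h

lemma pascal (a b : ℕ) : ((a + b + 2).choose (a + 1) : ℝ)
    = ((a + b + 1).choose a : ℝ) + ((a + b + 1).choose (a + 1) : ℝ) := by
  exact_mod_cast Nat.choose_succ_succ (a + b + 1) a

lemma deg_rec (lam : ℝ) (hlam : lam ≠ 0) (s n : ℕ) :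
    ((n : ℝ) + 1) * degHyperharmonic lam (s + 1) (n + 1)
      = ((n + s + 1).choose n : ℝ) + ((s : ℝ) + 1 - lam) * degHyperharmonic lam (s + 2) n := by
  induction s generalizing n with
  | zero =>
    induction n with
    | zero =>
      rw [deg_zero]
      simp [degHyperharmonic, degHarmonic, gbinom, hlam]
    | succ n ih =>
      rw [deg_succ]
      have e : degHyperharmonic lam (0 + 1) = degHarmonic lam := by
        funext m; simp [degHyperharmonic]
      rw [e] at ih ⊢
      rw [degHarmonic_succ lam (n + 1)]
      have h := deg_term lam hlam (n + 1)
      have c1 : ((n + 0 + 1).choose n : ℝ) = n + 1 := by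
        simp
      have c2 : ((n + 1 + 0 + 1).choose (n + 1) : ℝ) = n + 1 + 1 := by
        simp
      rw [c1] at ih
      rw [c2]
      push_cast at h ih ⊢
      linear_combination ih + h
  | succ s ihs =>
    induction n with
    | zero =>
      have := ihs 0
      rw [deg_zero] at *
      rw [deg_succ, deg_zero]
      simp at this ⊢
      exact this
    | succ n ih =>
      have h := ihs (n + 1)
      have p := pascal n (s + 1)
      rw [deg_succ lam (s + 1) n, deg_succ lam s (n + 1)]
      rw [show n + 1 + (s + 1) + 1 = n + (s + 1) + 2 by ring, p]
      rw [show n + 1 + s + 1 = n + (s + 1) + 1 by ring] at h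
      push_cast at h ih ⊢
      linear_combination h + ih

lemma hyp_rec (s k : ℕ) :
    ((k : ℝ) + 1) * hyperharmonicR (s + 1) (k + 1)
      = ((s : ℝ) + k + 1) * hyperharmonicR (s + 1) k + ((s + k).choose k : ℝ) := by
  induction s generalizing k with
  | zero =>
    simp only [hyperharmonicR, harmonicR]
    rw [Finset.sum_Icc_succ_top (by omega)]
    have : ((k : ℝ) + 1) ≠ 0 := by positivity
    simp
    field_simp
  | succ s ihs =>
    induction k with
    | zero =>
      have := ihs 0
      rw [hyp_zero] at *
      rw [hyp_succ, hyp_zero]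
      simp at this ⊢
      exact this
    | succ k ih =>
      have h := ihs (k + 1)
      have p := pascal k s
      have q := hyp_succ s k
      rw [hyp_succ s (k + 1)]
      rw [show s + 1 + (k + 1) = k + s + 2 by ring, p]
      rw [show s + (k + 1) = k + s + 1 by ring] at h
      rw [show s + 1 + k = k + s + 1 by ring] at ih
      push_cast at h ih ⊢
      linear_combination h + ih - ((s : ℝ) + k + 2) * q

lemma main_rec (lam : ℝ) (hlam : lam ≠ 0) (s : ℕ) (c : ℕ → ℝ) (hc1 : c 1 = 1)
    (hc : ∀ k : ℕ, 1 ≤ k → ((k : ℝ) + 1) * c (k + 1)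
      = ((s : ℝ) + k + 1) * c k + (-1 : ℝ) ^ k * gbinom (lam - (s + 1)) k)
    (k : ℕ) (hk : 1 ≤ k) : ∀ n : ℕ,
    ((n + k).choose k : ℝ) * degHyperharmonic lam (s + 1) (n + k)
      = ((n + s + k).choose n : ℝ) * c k
        + (-1 : ℝ) ^ k * gbinom (lam - (s + 1)) k * degHyperharmonic lam (k + s + 1) n := by
  induction k, hk using Nat.le_induction with
  | base =>
    intro n
    have h := deg_rec lam hlam s n
    rw [hc1, show 1 + s + 1 = s + 2 by ring]
    simp [gbinom] at h ⊢
    linear_combination h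
  | succ k hk ih =>
    intro n
    have h1 := ih (n + 1)
    have h2 := deg_rec lam hlam (k + s) n
    have h3 := hc k hk
    have h4 := gbinom_succ (lam - (s + 1)) k
    have b1 : ((k : ℝ) + 1) * ((n + (k + 1)).choose (k + 1) : ℝ)
        = ((n : ℝ) + 1) * ((n + 1 + k).choose k : ℝ) := by
      have := Nat.choose_succ_right_eq (n + (k + 1)) k
      rw [show n + (k + 1) - k = n + 1 by omega] at this
      have := congrArg (Nat.cast : ℕ → ℝ) this
      rw [show n + 1 + k = n + (k + 1) by ring]
      push_cast at this
      linear_combination this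
    have b2 : ((n : ℝ) + 1) * ((n + 1 + s + k).choose (n + 1) : ℝ)
        = ((s : ℝ) + k + 1) * ((n + s + (k + 1)).choose n : ℝ) := by
      have := Nat.choose_succ_right_eq (n + s + (k + 1)) n
      rw [show n + s + (k + 1) - n = s + k + 1 by omega] at this
      have := congrArg (Nat.cast : ℕ → ℝ) this
      rw [show n + 1 + s + k = n + s + (k + 1) by ring]
      push_cast at this
      linear_combination this
    have hk0 : ((k : ℝ) + 1) ≠ 0 := by positivity
    apply mul_left_cancel₀ hk0
    rw [show n + (k + s) + 1 = n + s + (k + 1) by ring] at h2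
    rw [show k + 1 + s + 1 = k + s + 2 by ring, pow_succ]
    rw [show n + 1 + k = n + (k + 1) by ring] at h1 b1
    push_cast at h2
    linear_combination degHyperharmonic lam (s + 1) (n + (k + 1)) * b1 + ((n : ℝ) + 1) * h1
      + c k * b2 + (-1 : ℝ) ^ k * gbinom (lam - (s + 1)) k * h2
      - ((n + s + (k + 1)).choose n : ℝ) * h3
      + (-1 : ℝ) ^ k * degHyperharmonic lam (k + s + 2) n * h4

/-- Equation (30) of the paper. -/
theorem degHyperharmonic_identity_explicit (lam : ℝ) (hlam : lam ≠ 0) (r k : ℕ) (hr : 1 ≤ r)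
    (hk : 1 ≤ k) (n : ℕ) :
    ((n + k).choose k : ℝ) * degHyperharmonic lam r (n + k) =
      ((n + r + k - 1).choose n : ℝ) * hyperharmonicR r k
        + ((n + r + k - 1).choose n : ℝ) * ((r + k - 1).choose k : ℝ) *
            ((∑ l ∈ Finset.Icc 2 k,
                (-1 : ℝ) ^ (l - 1) * gbinom (lam - r) (l - 1) /
                  (gbinom ((r : ℝ) + l - 2) (l - 1) * ((r : ℝ) + l - 1)))
              - ∑ l ∈ Finset.Icc 2 k, 1 / ((r : ℝ) + l - 1))
        + (-1 : ℝ) ^ k * gbinom (lam - r) k * degHyperharmonic lam (k + r) n := by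
  obtain ⟨s, rfl⟩ : ∃ s, r = s + 1 := ⟨r - 1, by omega⟩
  have e1 : n + (s + 1) + k - 1 = n + s + k := by omega
  have e2 : s + 1 + k - 1 = s + k := by omega
  have key := main_rec lam hlam s (fun k => hyperharmonicR (s + 1) k
    + ((s + k).choose k : ℝ) *
            ((∑ l ∈ Finset.Icc 2 k,
                (-1 : ℝ) ^ (l - 1) * gbinom (lam - ((s : ℝ) + 1)) (l - 1) /
                  (gbinom (((s : ℝ) + 1) + l - 2) (l - 1) * (((s : ℝ) + 1) + l - 1)))
              - ∑ l ∈ Finset.Icc 2 k, 1 / (((s : ℝ) + 1) + l - 1))) ?_ ?_ k hk n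
  · rw [e1, e2, show k + (s + 1) = k + s + 1 by ring]
    push_cast
    rw [key]
    ring
  · have h := hyp_rec s 0
    rw [hyp_zero] at h
    simpa using h
  · intro k hk
    have h := hyp_rec s k
    have hg := gbinom_nat s k
    have hpos : ((s + k).choose k : ℝ) ≠ 0 := by
      exact_mod_cast (Nat.choose_pos (by omega)).ne'
    have hs : ((s : ℝ) + k + 1) ≠ 0 := by positivity
    have hb : ((k : ℝ) + 1) * ((s + (k + 1)).choose (k + 1) : ℝ)
        = ((s : ℝ) + k + 1) * ((s + k).choose k : ℝ) := by
      have := congrArg (Nat.cast : ℕ → ℝ) (Nat.add_one_mul_choose_eq (s + k) k)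
      push_cast at this
      rw [show s + (k + 1) = s + k + 1 by ring]
      linear_combination -this
    beta_reduce
    rw [Finset.sum_Icc_succ_top (by omega), Finset.sum_Icc_succ_top (by omega)]
    rw [show k + 1 - 1 = k by omega,
      show (s : ℝ) + 1 + ((k + 1 : ℕ) : ℝ) - 2 = (s : ℝ) + k by push_cast; ring,
      show (s : ℝ) + 1 + ((k + 1 : ℕ) : ℝ) - 1 = (s : ℝ) + k + 1 by push_cast; ring, hg]
    generalize (∑ l ∈ Finset.Icc 2 k, (-1 : ℝ) ^ (l - 1) * gbinom (lam - ((s : ℝ) + 1)) (l - 1) /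
                  (gbinom (((s : ℝ) + 1) + l - 2) (l - 1) * (((s : ℝ) + 1) + l - 1))) = A
    generalize (∑ l ∈ Finset.Icc 2 k, 1 / (((s : ℝ) + 1) + l - 1)) = B
    rw [mul_add, ← mul_assoc, hb, h]
    field_simp
    ring
end

section
/- Let λ be a nonzero real number and let n, k be positive integers. Then C(n+k, k) · H_{n+k,λ} = C(n+k, n) · H_{k,λ} + (−1)^k · C(λ−1, k) · H_{n,λ}^{(k+1)}, where C(x, m) = x(x−1)⋯(x−m+1)/m! is the generalized binomial coefficient. -/
noncomputable def ascR (x : ℝ) : ℕ → ℝ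
  | 0 => 1
  | n + 1 => ascR x n * (x + n) / (n + 1)

lemma ascR_zero (x : ℝ) : ascR x 0 = 1 := rfl

lemma ascR_succ (x : ℝ) (n : ℕ) : ascR x (n + 1) = ascR x n * (x + n) / (n + 1) := rfl

lemma ascR_shift (x : ℝ) (n : ℕ) : ascR x (n + 1) = x * ascR (x + 1) n / (n + 1) := by
  induction n with
  | zero => simp [ascR]
  | succ n ih =>
    rw [ascR_succ, ih, ascR_succ (x + 1)]
    have h : (n : ℝ) + 1 ≠ 0 := by positivity
    have h2 : (n : ℝ) + 1 + 1 ≠ 0 := by positivity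
    push_cast
    field_simp
    ring

lemma ascR_pascal (x : ℝ) (n : ℕ) :
    ascR (x + 1) (n + 1) = ascR (x + 1) n + ascR x (n + 1) := by
  rw [ascR_shift x, ascR_succ]
  have h : (n : ℝ) + 1 ≠ 0 := by positivity
  field_simp
  ring

lemma gbinom_ascR (x : ℝ) (n : ℕ) : (-1 : ℝ) ^ n * gbinom x n = ascR (-x) n := by
  induction n with
  | zero => simp [gbinom, ascR]
  | succ n ih =>
    rw [ascR_succ, ← ih]
    unfold gbinom
    rw [Finset.prod_range_succ, Nat.factorial_succ]
    have h : (n : ℝ) + 1 ≠ 0 := by positivity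
    have h2 : (n.factorial : ℝ) ≠ 0 := by positivity
    push_cast
    field_simp
    ring

lemma lam_degHarmonic (lam : ℝ) (hlam : lam ≠ 0) (n : ℕ) :
    lam * degHarmonic lam n = 1 - ascR (1 - lam) n := by
  induction n with
  | zero => simp [degHarmonic, ascR]
  | succ n ih =>
    have e : degHarmonic lam (n + 1) =
        degHarmonic lam n + (-1 : ℝ) ^ n * (1 / lam) * gbinom lam (n + 1) := by
      unfold degHarmonic
      rw [Finset.sum_Icc_succ_top (by omega)]
      simp
    have g := gbinom_ascR lam (n + 1)
    have p := ascR_pascal (-lam) n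
    rw [show -lam + 1 = 1 - lam by ring] at p
    rw [e, mul_add, ih, p, ← g]
    field_simp
    ring

lemma lam_hyper (lam : ℝ) (hlam : lam ≠ 0) (k n : ℕ) :
    lam * degHyperharmonic lam (k + 1) n = ((n + k).choose k : ℝ) - ascR (k + 1 - lam) n := by
  induction k generalizing n with
  | zero => simpa [degHyperharmonic] using lam_degHarmonic lam hlam n
  | succ k ih =>
    induction n with
    | zero => simp [degHyperharmonic, ascR]
    | succ n ihn =>
      have e : degHyperharmonic lam (k + 1 + 1) (n + 1) =
          degHyperharmonic lam (k + 1 + 1) n + degHyperharmonic lam (k + 1) (n + 1) := by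
        simp only [degHyperharmonic]
        rw [Finset.sum_Icc_succ_top (by omega)]
      have p := ascR_pascal (k + 1 - lam) n
      rw [show (k : ℝ) + 1 - lam + 1 = ((k + 1 : ℕ) : ℝ) + 1 - lam by push_cast; ring] at p
      rw [e, mul_add, ihn, ih, p, show n + 1 + (k + 1) = (n + 1 + k) + 1 by ring,
        Nat.choose_succ_succ, show n + (k + 1) = n + 1 + k by ring]
      push_cast
      ring

lemma choose_ascR (x : ℝ) (k n : ℕ) :
    ((n + k).choose k : ℝ) * ascR x (n + k) = ascR x k * ascR (x + k) n := by
  induction n with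
  | zero => simp [ascR]
  | succ n ih =>
    have c : ((n + 1 + k).choose k : ℝ) * (n + 1) = ((n + k).choose k : ℝ) * (n + k + 1) := by
      have := Nat.choose_mul_succ_eq (n + k) k
      rw [show n + k + 1 - k = n + 1 by omega, show n + k + 1 = n + 1 + k by ring] at this
      have h : (((n + k).choose k * (n + 1 + k) : ℕ) : ℝ) =
        (((n + 1 + k).choose k * (n + 1) : ℕ) : ℝ) := by rw [this]
      push_cast at h
      linarith
    have h : (n : ℝ) + 1 ≠ 0 := by positivity
    have h2 : (n : ℝ) + k + 1 ≠ 0 := by positivity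
    have c' : ((n + 1 + k).choose k : ℝ) = ((n + k).choose k : ℝ) * (n + k + 1) / (n + 1) := by
      rw [eq_div_iff h, c]
    rw [c', show n + 1 + k = n + k + 1 by ring, ascR_succ, ascR_succ]
    push_cast
    field_simp
    linear_combination (x + n + k) * ih

/-- Equation (31) of the paper: `C(n+k,k) H_{n+k,λ} = C(n+k,n) H_{k,λ} + (-1)^k C(λ-1,k) H_{n,λ}^{(k+1)}`. -/
theorem degHarmonic_identity (lam : ℝ) (hlam : lam ≠ 0) (n k : ℕ) (hn : 1 ≤ n) (hk : 1 ≤ k) :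
    ((n + k).choose k : ℝ) * degHarmonic lam (n + k) =
      ((n + k).choose n : ℝ) * degHarmonic lam k
        + (-1 : ℝ) ^ k * gbinom (lam - 1) k * degHyperharmonic lam (k + 1) n := by
  have hs : (n + k).choose n = (n + k).choose k := Nat.choose_symm_add
  have a := lam_degHarmonic lam hlam (n + k)
  have b := lam_degHarmonic lam hlam k
  have c := lam_hyper lam hlam k n
  have d := choose_ascR (1 - lam) k n
  have g := gbinom_ascR (lam - 1) k
  rw [show -(lam - 1) = 1 - lam by ring] at g
  rw [show 1 - lam + (k : ℝ) = k + 1 - lam by ring] at d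
  rw [hs, g]
  apply mul_left_cancel₀ hlam
  linear_combination ((n + k).choose k : ℝ) * a - ((n + k).choose k : ℝ) * b
    - ascR (1 - lam) k * c - d
end

section
/- For all positive integers n and k, the hyperharmonic numbers satisfy H_n^{(k+1)} = C(n+k, n) · ( H_{n+k} − H_k ), where C(n+k, n) is the binomial coefficient. -/
theorem harmonicR_succ' (n : ℕ) : harmonicR (n + 1) = harmonicR n + 1 / ((n : ℝ) + 1) := by
  unfold harmonicR
  rw [Finset.sum_Icc_succ_top (by omega)]
  push_cast
  rfl

theorem hyperharmonic_aux (k : ℕ) : ∀ n : ℕ,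
    hyperharmonicR (k + 1) n = ((n + k).choose n : ℝ) * (harmonicR (n + k) - harmonicR k) := by
  induction k with
  | zero =>
    intro n
    simp [hyperharmonicR, harmonicR]
  | succ k ihk =>
    intro n
    induction n with
    | zero => simp [hyperharmonicR]
    | succ n ihn =>
      have h1 : hyperharmonicR (k + 1 + 1) (n + 1)
          = hyperharmonicR (k + 1 + 1) n + hyperharmonicR (k + 1) (n + 1) := by
        simp only [hyperharmonicR]
        rw [Finset.sum_Icc_succ_top (by omega)]
      rw [h1, ihn, ihk (n + 1)]
      have e1 : n + 1 + (k + 1) = (n + k + 1) + 1 := by omega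
      have e2 : n + (k + 1) = n + k + 1 := by omega
      have e3 : n + 1 + k = n + k + 1 := by omega
      rw [e1, e2, e3, harmonicR_succ' (n + k + 1), harmonicR_succ' k, Nat.choose_succ_succ (n + k + 1) n, Nat.succ_eq_add_one]
      have hc := Nat.choose_succ_right_eq (n + k + 1) n
      have e4 : n + k + 1 - n = k + 1 := by omega
      rw [e4] at hc
      have hc' : ((n + k + 1).choose (n + 1) : ℝ) * (n + 1)
          = ((n + k + 1).choose n : ℝ) * (k + 1) := by exact_mod_cast hc
      push_cast
      generalize ((n + k + 1).choose (n + 1) : ℝ) = b at *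
      generalize ((n + k + 1).choose n : ℝ) = a at *
      have hk : (k : ℝ) + 1 ≠ 0 := by positivity
      have hN : (n : ℝ) + k + 1 + 1 ≠ 0 := by positivity
      have key : (a + b) * (1 / ((n : ℝ) + k + 1 + 1)) = b * (1 / ((k : ℝ) + 1)) := by
        field_simp
        linear_combination -hc'
      linear_combination -key

/-- The Conway–Guy identity: `H_n^{(k+1)} = C(n+k,n)(H_{n+k} - H_k)`. -/
theorem hyperharmonic_eq (n k : ℕ) (hn : 1 ≤ n) (hk : 1 ≤ k) :
    hyperharmonicR (k + 1) n = ((n + k).choose n : ℝ) * (harmonicR (n + k) - harmonicR k) := by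
  exact hyperharmonic_aux k n
end

section
/- Let λ be a nonzero real number. For every real t with |t| < 1, the series Σ_{n=1}^{∞} H_{n,λ} t^n converges and equals −log_λ(1−t)/(1−t), where log_λ(1+x) = ((1+x)^λ − 1)/λ is the degenerate logarithm. -/
/-- Degenerate logarithm: `log_λ(1+x) = ((1+x)^λ - 1)/λ` (real power). -/
noncomputable def dlog (lam x : ℝ) : ℝ := ((1 + x) ^ lam - 1) / lam

theorem gbinom_eq_choose (x : ℝ) (n : ℕ) : gbinom x n = Ring.choose x n := by
  have h := Ring.descPochhammer_eq_factorial_smul_choose x n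
  have h' : (descPochhammer ℤ n).smeval x = ∏ i ∈ Finset.range n, (x - i) := by
    rw [← descPochhammer_eval_eq_prod_range, ← descPochhammer_map (Int.castRingHom ℝ),
      Polynomial.eval_map, ← algebraMap_int_eq, ← Polynomial.aeval_def, Polynomial.aeval_eq_smeval]
  rw [h'] at h
  unfold gbinom
  rw [h, nsmul_eq_mul]
  have : (n.factorial : ℝ) ≠ 0 := by positivity
  field_simp

theorem binom_hasSum (lam t : ℝ) (ht : |t| < 1) :
    HasSum (fun n : ℕ => gbinom lam n * (-t) ^ n) ((1 - t) ^ lam) := by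
  have h := (Real.one_add_rpow_hasFPowerSeriesOnBall_zero (a := lam)).hasSum (y := -t)
    (by simpa [enorm_eq_nnnorm] using! ht)
  simpa [binomialSeries, gbinom_eq_choose, sub_eq_add_neg, mul_comm] using h

/-- Generating function of the degenerate harmonic numbers:
for |t| < 1, `Σ_{n=1}^∞ H_{n,λ} t^n = -log_λ(1-t)/(1-t)`. -/
theorem degHarmonic_hasSum (lam : ℝ) (hlam : lam ≠ 0) (t : ℝ) (ht : |t| < 1) :
    HasSum (fun n : ℕ => degHarmonic lam (n + 1) * t ^ (n + 1))
      (-dlog lam (-t) / (1 - t)) := by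
  have h1 := (hasSum_nat_add_iff' 1).mpr (binom_hasSum lam t ht)
  have h2 := h1.mul_left (-1 / lam)
  have hg := hasSum_geometric_of_abs_lt_one ht
  have h3 := hasSum_sum_range_mul_of_summable_norm h2.summable.norm hg.summable.norm
  rw [h2.tsum_eq, hg.tsum_eq] at h3
  convert! h3 using 1
  · funext n
    unfold degHarmonic
    rw [Finset.sum_mul, ← Finset.Ico_add_one_right_eq_Icc, Finset.sum_Ico_eq_sum_range]
    refine Finset.sum_congr (by simp) fun k hk => ?_
    have hk' : k ≤ n := by simp at hk; omega
    obtain ⟨m, rfl⟩ := Nat.exists_eq_add_of_le hk'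
    rw [neg_pow t, Nat.add_sub_cancel_left, Nat.add_sub_cancel_left, add_comm 1 k]
    ring
  · simp [dlog, gbinom]
    ring
end

section
/- Let λ be a nonzero real number and let r be a positive integer. For every real z with |z| < 1, the series Σ_{n=1}^{∞} H_{n,λ}^{(r)} z^n converges and equals −log_λ(1−z)/(1−z)^r, where log_λ(1+x) = ((1+x)^λ − 1)/λ is the degenerate logarithm. -/
theorem gbinom_hasSum (lam z : ℝ) (hz : |z| < 1) :
    HasSum (fun n : ℕ => gbinom lam n * (-z) ^ n) ((1 - z) ^ lam) := by
  have h := (Real.one_add_rpow_hasFPowerSeriesOnBall_zero (a := lam)).hasSum (y := -z)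
    (by simpa [enorm_eq_nnnorm, ← NNReal.coe_lt_coe] using hz)
  simp only [binomialSeries_apply, List.ofFn_const, List.prod_replicate, smul_eq_mul,
    zero_add] at h
  simpa only [gbinom_eq_choose, sub_eq_add_neg] using h

theorem partial_sum_step (a : ℕ → ℝ) (z S : ℝ) (hz : |z| < 1)
    (h : HasSum (fun n : ℕ => a (n + 1) * z ^ (n + 1)) S) :
    HasSum (fun n : ℕ => (∑ j ∈ Finset.Icc 1 (n + 1), a j) * z ^ (n + 1)) (S / (1 - z)) := by
  have hg := hasSum_geometric_of_abs_lt_one hz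
  have key := hasSum_sum_range_mul_of_summable_norm h.summable.norm hg.summable.norm
  rw [h.tsum_eq, hg.tsum_eq, ← div_eq_mul_inv] at key
  suffices e : (fun n : ℕ => (∑ j ∈ Finset.Icc 1 (n + 1), a j) * z ^ (n + 1)) =
      fun n : ℕ => ∑ k ∈ Finset.range (n + 1), a (k + 1) * z ^ (k + 1) * z ^ (n - k) by
    rw [e]
    exact key
  funext n
  rw [Finset.sum_mul, Finset.range_eq_Ico,
    Finset.sum_Ico_eq_sum_range, ← Finset.Ico_succ_right_eq_Icc, Finset.sum_Ico_eq_sum_range]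
  refine Finset.sum_congr (by simp) fun k hk => ?_
  have hk' : k ≤ n := by simp at hk; omega
  obtain ⟨m, rfl⟩ := Nat.exists_eq_add_of_le hk'
  simp only [zero_add, Nat.add_sub_cancel_left, add_comm 1 k]
  ring

/-- Generating function of the degenerate hyperharmonic numbers:
for |z| < 1, `Σ_{n=1}^∞ H_{n,λ}^{(r)} z^n = -log_λ(1-z)/(1-z)^r`. -/
theorem degHyperharmonic_hasSum (lam : ℝ) (hlam : lam ≠ 0) (r : ℕ) (hr : 1 ≤ r)
    (z : ℝ) (hz : |z| < 1) :
    HasSum (fun n : ℕ => degHyperharmonic lam r (n + 1) * z ^ (n + 1))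
      (-dlog lam (-z) / (1 - z) ^ r) := by
  induction r, hr using Nat.le_induction with
  | base =>
    have h0 := (hasSum_nat_add_iff' 1).2 (gbinom_hasSum lam z hz)
    have h1 := h0.mul_left (-(1 / lam))
    have h2 := partial_sum_step (fun j => (-1 : ℝ) ^ (j - 1) * (1 / lam) * gbinom lam j) z
      (-dlog lam (-z)) hz (by
        have e1 : (fun n : ℕ => (-1 : ℝ) ^ (n + 1 - 1) * (1 / lam) * gbinom lam (n + 1)
            * z ^ (n + 1)) =
            fun i : ℕ => -(1 / lam) * (gbinom lam (i + 1) * (-z) ^ (i + 1)) := by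
          funext n
          rw [neg_pow z (n + 1), pow_succ (-1 : ℝ) n, Nat.add_sub_cancel]
          ring
        have e2 : -dlog lam (-z) = -(1 / lam) *
            ((1 - z) ^ lam - ∑ i ∈ Finset.range 1, gbinom lam i * (-z) ^ i) := by
          simp [dlog, gbinom, sub_eq_add_neg]
          ring
        rw [e2]
        exact e1 ▸ h1)
    simpa [degHyperharmonic, degHarmonic] using h2
  | succ r hr ih =>
    have h2 := partial_sum_step _ z _ hz ih
    obtain ⟨s, rfl⟩ := Nat.exists_eq_add_of_le' hr
    rw [pow_succ, ← div_div]
    simpa only [degHyperharmonic] using h2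
end

section
/- Let r be a positive integer. For every real t with |t| < 1, the series Σ_{n=1}^{∞} H_n^{(r)} t^n converges and equals −log(1−t)/(1−t)^r, where log is the natural logarithm. -/
theorem hyperharmonicR_succ_aux (r n : ℕ) :
    hyperharmonicR (r + 1) (n + 1) = ∑ k ∈ Finset.range (n + 1), hyperharmonicR r (k + 1) := by
  have key : ∀ f : ℕ → ℝ, ∑ j ∈ Finset.Icc 1 (n + 1), f j
      = ∑ k ∈ Finset.range (n + 1), f (k + 1) := by
    intro f
    rw [← Finset.Ico_add_one_right_eq_Icc, Finset.sum_Ico_eq_sum_range]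
    simp [add_comm]
  cases r with
  | zero =>
    simp only [hyperharmonicR, harmonicR]
    rw [key]
    simp
  | succ r =>
    simp only [hyperharmonicR]
    rw [key]

theorem hyperharmonic_hasSum_aux (t : ℝ) (ht : |t| < 1) (r : ℕ) :
    HasSum (fun n : ℕ => hyperharmonicR r (n + 1) * t ^ (n + 1))
      (-Real.log (1 - t) / (1 - t) ^ r) := by
  induction r with
  | zero =>
    have h := Real.hasSum_pow_div_log_of_abs_lt_one ht
    convert h using 1
    · funext n
      simp [hyperharmonicR]
      ring
    · simp
  | succ r ih =>
    have hg := hasSum_geometric_of_abs_lt_one ht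
    have h := hasSum_sum_range_mul_of_summable_norm ih.summable.norm hg.summable.norm
    rw [ih.tsum_eq, hg.tsum_eq] at h
    convert h using 1
    · rfl
    · funext n
      rw [hyperharmonicR_succ_aux, Finset.sum_mul]
      refine Finset.sum_congr rfl fun k hk => ?_
      have hk' : k ≤ n := Nat.lt_succ_iff.mp (Finset.mem_range.mp hk)
      rw [mul_assoc, ← pow_add]
      congr 2
      omega
    · rw [pow_succ, div_mul_eq_div_div, div_eq_mul_inv _ (1 - t)]

/-- Generating function of the hyperharmonic numbers:
for |t| < 1, `Σ_{n=1}^∞ H_n^{(r)} t^n = -log(1-t)/(1-t)^r`. -/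
theorem hyperharmonic_hasSum (r : ℕ) (hr : 1 ≤ r) (t : ℝ) (ht : |t| < 1) :
    HasSum (fun n : ℕ => hyperharmonicR r (n + 1) * t ^ (n + 1))
      (-Real.log (1 - t) / (1 - t) ^ r) := by
  exact hyperharmonic_hasSum_aux t ht r
end

section
/- Let λ be a nonzero real number and let r, k be positive integers. For every real z with |z| < 1, the k-th derivative of z ↦ −log_λ(1−z)/(1−z)^r at z equals ( r(r+1)⋯(r+k−1)/(1−z)^{r+k} ) · ( 1/r + Σ_{l=2}^{k} (1/(r+l−1)) · ∏_{j=0}^{l−2} (1 − λ/(r+j)) ) − r(r+1)⋯(r+k−1) · ( ∏_{l=0}^{k−1} (1 − λ/(r+l)) ) · log_λ(1−z)/(1−z)^{r+k}, where log_λ(1+x) = ((1+x)^λ − 1)/λ is the degenerate logarithm. -/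
theorem dlog_aux_hasDerivAt (lam : ℝ) (hlam : lam ≠ 0) (n : ℕ) (A B z : ℝ) (hz : z < 1) :
    HasDerivAt (fun z : ℝ => (A - B * dlog lam (-z)) / (1 - z) ^ n)
      ((n * A + B - B * (n - lam) * dlog lam (-z)) / (1 - z) ^ (n + 1)) z := by
  have hw : 0 < 1 - z := by linarith
  have h1 : HasDerivAt (fun z : ℝ => 1 - z) (-1) z := by
    simpa using (hasDerivAt_id z).const_sub 1
  have h2 : HasDerivAt (fun z : ℝ => dlog lam (-z)) (-(1 + lam * dlog lam (-z)) / (1 - z)) z := by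
    have h := ((h1.rpow_const (p := lam) (Or.inl hw.ne')).sub_const 1).div_const lam
    have e : (fun z : ℝ => dlog lam (-z)) = fun z : ℝ => ((1 - z) ^ lam - 1) / lam := by
      funext x; simp [dlog, sub_eq_add_neg]
    have e' : dlog lam (-z) = ((1 - z) ^ lam - 1) / lam := congrFun e z
    rw [e, e']
    refine h.congr_deriv ?_
    rw [Real.rpow_sub_one hw.ne']
    field_simp
    ring
  have h3 := ((h2.const_mul B).const_sub A).div (h1.pow n) (pow_ne_zero n hw.ne')
  refine HasDerivAt.congr_deriv (f := fun z : ℝ => (A - B * dlog lam (-z)) / (1 - z) ^ n) h3 ?_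
  generalize dlog lam (-z) = L
  rcases n with _ | n
  · simp
    field_simp
    ring
  · simp only [Nat.add_sub_cancel, Pi.pow_apply]
    push_cast
    field_simp
    ring

theorem dlog_aux_iter (lam : ℝ) (hlam : lam ≠ 0) (r : ℕ) (hr : 1 ≤ r) (k : ℕ) :
    ∀ z : ℝ, z < 1 → iteratedDeriv k (fun z : ℝ => -dlog lam (-z) / (1 - z) ^ r) z =
      ((∏ i ∈ Finset.range k, ((r : ℝ) + i)) * (∑ l ∈ Finset.range k,
            (1 / ((r : ℝ) + l)) * ∏ j ∈ Finset.range l, (1 - lam / ((r : ℝ) + j)))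
        - (∏ i ∈ Finset.range k, ((r : ℝ) + i)) *
            (∏ l ∈ Finset.range k, (1 - lam / ((r : ℝ) + l))) *
            dlog lam (-z)) / (1 - z) ^ (r + k) := by
  induction k with
  | zero => intro z hz; simp
  | succ k ih =>
    intro z hz
    rw [iteratedDeriv_succ]
    have he := Filter.eventuallyEq_of_mem (Iio_mem_nhds hz) (fun x hx => ih x hx)
    rw [he.deriv_eq, (dlog_aux_hasDerivAt lam hlam (r + k) _ _ z hz).deriv]
    have hn : (r : ℝ) + k ≠ 0 := by positivity
    simp only [Finset.prod_range_succ, Finset.sum_range_succ]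
    rw [← add_assoc r k 1]
    congr 1
    push_cast
    field_simp

theorem dlog_aux_sum (lam : ℝ) (r : ℕ) (k : ℕ) (hk : 1 ≤ k) :
    (1 / (r : ℝ) + ∑ l ∈ Finset.Icc 2 k,
      (1 / ((r : ℝ) + l - 1)) * ∏ j ∈ Finset.range (l - 1), (1 - lam / ((r : ℝ) + j))) =
    ∑ l ∈ Finset.range k,
      (1 / ((r : ℝ) + l)) * ∏ j ∈ Finset.range l, (1 - lam / ((r : ℝ) + j)) := by
  induction k, hk using Nat.le_induction with
  | base => simp
  | succ k hk ih =>
    rw [Finset.sum_Icc_succ_top (by omega), Finset.sum_range_succ, ← ih, ← add_assoc]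
    simp only [Nat.add_sub_cancel]
    push_cast
    rw [← add_assoc, add_sub_cancel_right]


/-- Equation (25) of the paper: explicit formula for the k-th derivative of
`z ↦ -log_λ(1-z)/(1-z)^r` on |z| < 1. -/
theorem iteratedDeriv_neg_dlog_div (lam : ℝ) (hlam : lam ≠ 0) (r k : ℕ) (hr : 1 ≤ r)
    (hk : 1 ≤ k) (z : ℝ) (hz : |z| < 1) :
    iteratedDeriv k (fun z : ℝ => -dlog lam (-z) / (1 - z) ^ r) z =
      (∏ i ∈ Finset.range k, ((r : ℝ) + i)) / (1 - z) ^ (r + k) *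
          (1 / (r : ℝ) + ∑ l ∈ Finset.Icc 2 k,
            (1 / ((r : ℝ) + l - 1)) * ∏ j ∈ Finset.range (l - 1), (1 - lam / ((r : ℝ) + j)))
        - (∏ i ∈ Finset.range k, ((r : ℝ) + i)) *
            (∏ l ∈ Finset.range k, (1 - lam / ((r : ℝ) + l))) *
            dlog lam (-z) / (1 - z) ^ (r + k) := by
  rw [dlog_aux_iter lam hlam r hr k z (abs_lt.mp hz).2, dlog_aux_sum lam r k hk]
  ring
end

section
/- Let λ be a nonzero real number and let r, k be positive integers. For every real z with |z| < 1, the k-th derivative of z ↦ −log_λ(1−z)/(1−z)^r at z equals k! · Σ_{n=0}^{∞} C(n+k, k) · H_{n+k,λ}^{(r)} · z^n, where C(n+k, k) is the binomial coefficient and log_λ(1+x) = ((1+x)^λ − 1)/λ is the degenerate logarithm. -/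
theorem aux_congr {f g : ℕ → ℝ} {a : ℝ} (h : ∀ n, f n = g n) (H : HasSum f a) : HasSum g a := by
  rwa [← funext h]

theorem aux_fps (c : ℕ → ℝ) (F : ℝ → ℝ)
    (h : ∀ z : ℝ, |z| < 1 → HasSum (fun n => c n * z ^ n) (F z)) :
    HasFPowerSeriesOnBall F (FormalMultilinearSeries.ofScalars ℝ c) 0 1 := by
  refine ⟨?_, one_pos, ?_⟩
  · refine ENNReal.le_of_forall_nnreal_lt fun r hr => ?_
    have hr' : (r : ℝ) < 1 := by exact_mod_cast hr
    apply FormalMultilinearSeries.le_radius_of_summable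
    have := (h r (by rw [abs_of_nonneg r.coe_nonneg]; exact hr')).summable.norm
    refine this.congr fun n => ?_
    simp [FormalMultilinearSeries.ofScalars_norm]
  · intro y hy
    have hy' : |y| < 1 := by
      rw [← ENNReal.ofReal_one, Metric.eball_ofReal] at hy
      simpa using hy
    have := h y hy'
    simpa [FormalMultilinearSeries.ofScalars_apply_eq, mul_comm] using this

theorem aux_deriv (c : ℕ → ℝ) (F : ℝ → ℝ)
    (h : ∀ z : ℝ, |z| < 1 → HasSum (fun n => c n * z ^ n) (F z)) :
    ∀ z : ℝ, |z| < 1 → HasSum (fun n : ℕ => ((n : ℝ) + 1) * c (n + 1) * z ^ n) (deriv F z) := by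
  intro z hz
  have h1 := (aux_fps c F h).fderiv
  have hz' : z ∈ Metric.eball (0 : ℝ) 1 := by
    rw [← ENNReal.ofReal_one, Metric.eball_ofReal]
    simpa using hz
  have h2 := h1.hasSum hz'
  have h3 := h2.mapL (ContinuousLinearMap.apply ℝ ℝ (1 : ℝ))
  simp only [zero_add, ContinuousLinearMap.apply_apply, fderiv_apply_one_eq_deriv] at h3
  refine aux_congr ?_ h3
  intro n
  rw [FormalMultilinearSeries.apply_eq_pow_smul_coeff]
  simp only [ContinuousLinearMap.smul_apply, FormalMultilinearSeries.derivSeries_coeff_one,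
    FormalMultilinearSeries.coeff_ofScalars]
  simp
  ring

theorem aux_iter (c : ℕ → ℝ) (F : ℝ → ℝ)
    (h : ∀ z : ℝ, |z| < 1 → HasSum (fun n => c n * z ^ n) (F z)) (k : ℕ) :
    ∀ z : ℝ, |z| < 1 → HasSum (fun n : ℕ => (Nat.factorial k : ℝ) * ((n + k).choose k : ℝ)
      * c (n + k) * z ^ n) (iteratedDeriv k F z) := by
  induction k with
  | zero => simpa using h
  | succ k ih =>
    intro z hz
    rw [iteratedDeriv_succ]
    convert aux_deriv (fun n : ℕ => (Nat.factorial k : ℝ) * ((n + k).choose k : ℝ)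
      * c (n + k)) _ ih z hz using 3 with n
    have e : n + 1 + k = n + (k + 1) := by ring
    rw [e]
    have := Nat.choose_succ_right_eq (n + (k + 1)) k
    have e2 : n + (k + 1) - k = n + 1 := by omega
    rw [e2] at this
    have this' : ((n + (k + 1)).choose (k + 1) : ℝ) * (k + 1) =
      ((n + (k + 1)).choose k : ℝ) * (n + 1) := by exact_mod_cast this
    rw [Nat.factorial_succ]
    push_cast
    linear_combination (k.factorial : ℝ) * c (n + (k + 1)) * this'

theorem aux_geom (c : ℕ → ℝ) (z s : ℝ) (hz : |z| < 1)
    (h : HasSum (fun n => c n * z ^ n) s) :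
    HasSum (fun n => (∑ j ∈ Finset.range (n + 1), c j) * z ^ n) (s / (1 - z)) := by
  have h2 := hasSum_geometric_of_abs_lt_one hz
  have := hasSum_sum_range_mul_of_summable_norm h.summable.norm h2.summable.norm
  rw [h.tsum_eq, h2.tsum_eq, ← div_eq_mul_inv] at this
  refine aux_congr ?_ this
  intro n
  rw [Finset.sum_mul]
  refine Finset.sum_congr rfl fun j hj => ?_
  rw [mul_assoc, ← pow_add]
  congr 2
  have := Finset.mem_range.1 hj
  omega

theorem aux_gbinom (x : ℝ) (n : ℕ) : Ring.choose x n = gbinom x n := by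
  rw [Ring.choose_eq_smul, gbinom, ← descPochhammer_eval_eq_prod_range]
  have : (descPochhammer ℤ n).smeval x = (descPochhammer ℝ n).eval x := by
    rw [← Polynomial.aeval_eq_smeval, ← descPochhammer_map (algebraMap ℤ ℝ),
      Polynomial.eval_map_algebraMap]
  rw [this]
  simp [div_eq_inv_mul]

theorem aux_range (c : ℕ → ℝ) (h0 : c 0 = 0) (n : ℕ) :
    ∑ j ∈ Finset.range (n + 1), c j = ∑ j ∈ Finset.Icc 1 n, c j := by
  rw [Finset.sum_range_succ', h0, add_zero, Finset.range_eq_Ico, Finset.sum_Ico_add' c 0 n 1]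
  rfl

theorem aux_base (lam z : ℝ) (hz : |z| < 1) :
    HasSum (fun n : ℕ => (if n = 0 then 0 else (-1 : ℝ) ^ (n - 1) * (1 / lam) * gbinom lam n) * z ^ n)
      (-dlog lam (-z)) := by
  have hz' : -z ∈ Metric.eball (0 : ℝ) 1 := by
    rw [← ENNReal.ofReal_one, Metric.eball_ofReal]
    simpa using hz
  have h := (Real.one_add_rpow_hasFPowerSeriesOnBall_zero (a := lam)).hasSum hz'
  simp only [zero_add, binomialSeries_apply, aux_gbinom] at h
  have h1 := ((h.sub (hasSum_ite_eq (0 : ℕ) (1 : ℝ))).div_const lam).neg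
  unfold dlog
  refine aux_congr ?_ h1
  intro n
  rcases n with _ | n
  · simp [gbinom]
  · simp [neg_pow z]
    ring

theorem aux_hyper_zero (lam : ℝ) (r : ℕ) : degHyperharmonic lam r 0 = 0 := by
  rcases r with _ | _ | r <;> simp [degHyperharmonic, degHarmonic]

theorem aux_main (lam : ℝ) (r : ℕ) (z : ℝ) (hz : |z| < 1) :
    HasSum (fun n => degHyperharmonic lam (r + 1) n * z ^ n) (-dlog lam (-z) / (1 - z) ^ (r + 1)) := by
  induction r with
  | zero =>
    have := aux_geom _ z _ hz (aux_base lam z hz)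
    rw [zero_add, pow_one]
    refine aux_congr (fun n => ?_) this
    rw [aux_range _ (by simp)]
    simp only [degHyperharmonic, degHarmonic]
    congr 1
    refine Finset.sum_congr rfl fun j hj => ?_
    have := (Finset.mem_Icc.1 hj).1
    rw [if_neg (by omega)]
  | succ r ih =>
    have := aux_geom _ z _ hz ih
    rw [pow_succ, ← div_div]
    refine aux_congr (fun n => ?_) this
    rw [aux_range _ (aux_hyper_zero _ _)]
    simp only [degHyperharmonic]

/-- Equation (19) of the paper: for |z| < 1, the k-th derivative of
`z ↦ -log_λ(1-z)/(1-z)^r` equals `k! Σ_{n=0}^∞ C(n+k,k) H_{n+k,λ}^{(r)} z^n`. -/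
theorem iteratedDeriv_eq_hasSum (lam : ℝ) (hlam : lam ≠ 0) (r k : ℕ) (hr : 1 ≤ r)
    (hk : 1 ≤ k) (z : ℝ) (hz : |z| < 1) :
    HasSum
      (fun n : ℕ =>
        (Nat.factorial k : ℝ) * ((n + k).choose k : ℝ) * degHyperharmonic lam r (n + k) * z ^ n)
      (iteratedDeriv k (fun z : ℝ => -dlog lam (-z) / (1 - z) ^ r) z) := by
  obtain ⟨r, rfl⟩ : ∃ m, r = m + 1 := ⟨r - 1, by omega⟩
  exact aux_iter _ _ (fun z hz => aux_main lam r z hz) k z hz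
end
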